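/- Order comparison of real algebraic numbers given by a defining integer polynomial and an isolating rational interval is computable. Precisely: there exists a computable function g taking two codes, each of the form (a, b, c) with a : List ℤ (the coefficient list of an integer polynomial) and b, c : ℚ, and returning a Boolean, with the following property: whenever both codes are valid — meaning that for each code the encoded integer polynomial is nonzero and has exactly one real root in the closed interval [b, c] — g returns true on the pair of codes if and only if the unique root α encoded by the first code satisfies α ≤ α′, where α′ is the unique root encoded by the second code. -/

import Mathlib

/-- Real evaluation of an integer polynomial encoded by its coefficient list
`a`, representing `∑ₖ aₖ Xᵏ`. -/
def intListEval (a : List ℤ) (x : ℝ) : ℝ :=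
  (a.zipIdx.map fun p => (p.1 : ℝ) * x ^ p.2).sum

/-- A code `(a, b, c)` is valid if the encoded integer polynomial is nonzero
and has exactly one real root in the closed interval `[b, c]`. -/
def AlgCodeValid (c : List ℤ × ℚ × ℚ) : Prop :=
  (∃ k ∈ c.1, k ≠ 0) ∧
    ∃! α : ℝ, α ∈ Set.Icc (c.2.1 : ℝ) (c.2.2 : ℝ) ∧ intListEval c.1 α = 0

namespace AlgCmp

open Encodable

/-! ### Unbounded search with guaranteed success -/

theorem search {α β : Type} [Primcodable α] [Primcodable β] (R : α → β → Prop)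
    (hR : PrimrecRel R) (hex : ∀ a, ∃ b, R a b) :
    ∃ F : α → β, Computable F ∧ ∀ a, R a (F a) := by
  classical
  let f : α → ℕ → Option β := fun a n => (decode (α := β) n).bind
    fun b => if R a b then some b else none
  have hf : Primrec₂ f := by
    refine Primrec.option_bind (Primrec.decode.comp Primrec.snd) ?_
    refine Primrec.ite ?_ (Primrec.option_some.comp Primrec.snd) (Primrec.const none)
    exact hR.comp (Primrec.fst.comp Primrec.fst) Primrec.snd
  have hp : Partrec fun a => Nat.rfindOpt (f a) := Partrec.rfindOpt hf.to_comp
  have hd : ∀ a, (Nat.rfindOpt (f a)).Dom := by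
    intro a
    obtain ⟨b, hb⟩ := hex a
    rw [Nat.rfindOpt_dom]
    exact ⟨encode b, b, by simp [f, hb]⟩
  refine ⟨fun a => (Nat.rfindOpt (f a)).get (hd a), hp.of_eq_tot fun a => Part.get_mem _, ?_⟩
  intro a
  obtain ⟨n, hn⟩ := Nat.rfindOpt_spec (Part.get_mem (hd a))
  show R a ((Nat.rfindOpt (f a)).get (hd a))
  generalize (Nat.rfindOpt (f a)).get (hd a) = b at hn ⊢
  simp only [f, Option.mem_def, Option.bind_eq_some_iff] at hn
  obtain ⟨c, -, hc⟩ := hn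
  split_ifs at hc with h
  cases hc
  exact h

/-! ### Integer arithmetic is primitive recursive -/

theorem encode_int (z : ℤ) : encode z = if 0 ≤ z then 2 * z.toNat else 2 * (-z).toNat - 1 := by
  rcases z with n | n
  · have : encode (Int.ofNat n) = 2 * n := rfl
    rw [this]; simp
  · have : encode (Int.negSucc n) = 2 * n + 1 := rfl
    rw [this]
    have h : ¬ (0 ≤ Int.negSucc n) := by simp
    have h2 : (-Int.negSucc n).toNat = n + 1 := by simp
    rw [if_neg h, h2]; omega

theorem toNat_pr : Primrec Int.toNat := by
  have h : Primrec fun z : ℤ => if (encode z) % 2 = 0 then encode z / 2 else 0 :=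
    Primrec.ite (Primrec.eq.comp (Primrec.nat_mod.comp Primrec.encode (Primrec.const 2))
      (Primrec.const 0)) (Primrec.nat_div.comp Primrec.encode (Primrec.const 2)) (Primrec.const 0)
  refine h.of_eq fun z => ?_
  rw [encode_int]
  split_ifs <;> omega

theorem negToNat_pr : Primrec fun z : ℤ => (-z).toNat := by
  have h : Primrec fun z : ℤ => if (encode z) % 2 = 0 then 0 else (encode z + 1) / 2 :=
    Primrec.ite (Primrec.eq.comp (Primrec.nat_mod.comp Primrec.encode (Primrec.const 2))
      (Primrec.const 0)) (Primrec.const 0)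
      (Primrec.nat_div.comp (Primrec.succ.comp Primrec.encode) (Primrec.const 2))
  refine h.of_eq fun z => ?_
  rw [encode_int]
  split_ifs <;> omega

theorem subNat_pr : Primrec₂ fun a b : ℕ => (a : ℤ) - b := by
  have h : Primrec fun p : ℕ × ℕ => Denumerable.ofNat ℤ
      (if p.2 ≤ p.1 then 2 * (p.1 - p.2) else 2 * (p.2 - p.1) - 1) := by
    refine (Primrec.ofNat ℤ).comp (Primrec.ite (Primrec.nat_le.comp Primrec.snd Primrec.fst) ?_ ?_)
    · exact Primrec.nat_mul.comp (Primrec.const 2) (Primrec.nat_sub.comp Primrec.fst Primrec.snd)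
    · exact Primrec.nat_sub.comp (Primrec.nat_mul.comp (Primrec.const 2)
        (Primrec.nat_sub.comp Primrec.snd Primrec.fst)) (Primrec.const 1)
  refine h.of_eq fun p => ?_
  obtain ⟨a, b⟩ := p
  have : (if b ≤ a then 2 * (a - b) else 2 * (b - a) - 1) = encode ((a : ℤ) - b) := by
    rw [encode_int]
    split_ifs <;> omega
  simp only [this, Denumerable.ofNat_encode]

section
variable {α : Type} [Primcodable α] {f g : α → ℤ}

theorem zadd (hf : Primrec f) (hg : Primrec g) : Primrec fun a => f a + g a := by
  have h := subNat_pr.comp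
    (Primrec.nat_add.comp (toNat_pr.comp hf) (toNat_pr.comp hg))
    (Primrec.nat_add.comp (negToNat_pr.comp hf) (negToNat_pr.comp hg))
  refine h.of_eq fun a => ?_
  push_cast; omega

theorem zneg (hf : Primrec f) : Primrec fun a => - f a := by
  have h := subNat_pr.comp (negToNat_pr.comp hf) (toNat_pr.comp hf)
  refine h.of_eq fun a => ?_
  omega

theorem zmul (hf : Primrec f) (hg : Primrec g) : Primrec fun a => f a * g a := by
  have h := subNat_pr.comp
    (Primrec.nat_add.comp (Primrec.nat_mul.comp (toNat_pr.comp hf) (toNat_pr.comp hg))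
      (Primrec.nat_mul.comp (negToNat_pr.comp hf) (negToNat_pr.comp hg)))
    (Primrec.nat_add.comp (Primrec.nat_mul.comp (toNat_pr.comp hf) (negToNat_pr.comp hg))
      (Primrec.nat_mul.comp (negToNat_pr.comp hf) (toNat_pr.comp hg)))
  refine h.of_eq fun a => ?_
  have e1 : f a = ((f a).toNat : ℤ) - ((-f a).toNat : ℤ) := by omega
  have e2 : g a = ((g a).toNat : ℤ) - ((-g a).toNat : ℤ) := by omega
  conv_rhs => rw [e1, e2]
  push_cast; ring

theorem zabs (hf : Primrec f) : Primrec fun a => |f a| := by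
  have h := subNat_pr.comp
    (Primrec.nat_add.comp (toNat_pr.comp hf) (negToNat_pr.comp hf)) (Primrec.const 0)
  refine h.of_eq fun a => ?_
  rcases abs_cases (f a) with h | h <;> push_cast <;> omega

theorem zcast {f : α → ℕ} (hf : Primrec f) : Primrec fun a => (f a : ℤ) := by
  have h := subNat_pr.comp hf (Primrec.const 0)
  exact h.of_eq fun a => by simp

theorem zle (hf : Primrec f) (hg : Primrec g) : PrimrecPred fun a => f a ≤ g a := by
  have h : PrimrecPred fun a => (f a + - g a).toNat = 0 :=
    Primrec.eq.comp (toNat_pr.comp (zadd hf (zneg hg))) (Primrec.const 0)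
  refine h.of_eq fun a => ?_
  omega

theorem zlt (hf : Primrec f) (hg : Primrec g) : PrimrecPred fun a => f a < g a := by
  refine (zle hg hf).not.of_eq fun a => ?_
  omega

theorem zeq (hf : Primrec f) (hg : Primrec g) : PrimrecPred fun a => f a = g a :=
  Primrec.eq.comp hf hg

theorem zpow {n : α → ℕ} (hf : Primrec f) (hn : Primrec n) : Primrec fun a => f a ^ n a := by
  have h : Primrec fun a => Nat.rec (motive := fun _ => ℤ) 1 (fun _ r => r * f a) (n a) :=
    Primrec.nat_rec' hn (Primrec.const 1)
      (zmul (Primrec.snd.comp Primrec.snd) (hf.comp Primrec.fst)).to₂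
  refine h.of_eq fun a => ?_
  generalize n a = k
  induction k with
  | zero => simp
  | succ k ih => rw [pow_succ]; simp only [← ih]

theorem pforall {P : α → ℕ → Prop} {n : α → ℕ} (hP : PrimrecRel P) (hn : Primrec n) :
    PrimrecPred fun a => ∀ x < n a, P a x := by
  have h := PrimrecRel.comp (R := fun (L : List ℕ) (a : α) => ∀ x ∈ L, P a x)
    (PrimrecRel.forall_mem_list (R := fun x a => P a x) hP.swap)
    (Primrec.list_range.comp hn) Primrec.id
  refine h.of_eq fun a => ?_
  simp

end

/-! ### Numerators and denominators of rationals are computable -/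

/-- The pairs encoding reduced fractions. -/
def okc (m : ℕ) : Prop :=
  0 < m.unpair.2 ∧ (Denumerable.ofNat ℤ m.unpair.1).natAbs.Coprime m.unpair.2

theorem coprime_iff (a b : ℕ) (hb : 0 < b) :
    a.Coprime b ↔ ∀ x < b + 1, a % x = 0 → b % x = 0 → x = 1 := by
  constructor
  · intro h x _ ha hb
    exact Nat.eq_one_of_dvd_coprimes h (Nat.dvd_of_mod_eq_zero ha) (Nat.dvd_of_mod_eq_zero hb)
  · intro h
    exact h _ (Nat.lt_succ_of_le (Nat.le_of_dvd hb (Nat.gcd_dvd_right a b)))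
      (Nat.mod_eq_zero_of_dvd (Nat.gcd_dvd_left a b))
      (Nat.mod_eq_zero_of_dvd (Nat.gcd_dvd_right a b))

theorem okc_pr : PrimrecPred okc := by
  have hu2 : Primrec fun m : ℕ => m.unpair.2 := Primrec.snd.comp Primrec.unpair
  have hz : Primrec fun m : ℕ => Denumerable.ofNat ℤ m.unpair.1 :=
    (Primrec.ofNat ℤ).comp (Primrec.fst.comp Primrec.unpair)
  have hna : Primrec fun m : ℕ => (|Denumerable.ofNat ℤ m.unpair.1|).toNat :=
    toNat_pr.comp (zabs hz)
  have hmod : ∀ {f : ℕ → ℕ}, Primrec f → PrimrecPred fun p : ℕ × ℕ => f p.1 % p.2 = 0 :=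
    fun hf => Primrec.eq.comp (Primrec.nat_mod.comp (hf.comp Primrec.fst) Primrec.snd)
      (Primrec.const 0)
  have hrel : PrimrecRel fun (m x : ℕ) => ¬ ((|Denumerable.ofNat ℤ m.unpair.1|).toNat % x = 0 ∧
      m.unpair.2 % x = 0) ∨ x = 1 :=
    (((hmod hna).and (hmod hu2)).not.or (Primrec.eq.comp Primrec.snd (Primrec.const 1)))
  have := (Primrec.nat_lt.comp (Primrec.const 0) hu2).and
    (pforall hrel (Primrec.succ.comp hu2))
  refine this.of_eq fun m => ?_
  unfold okc
  refine and_congr_right fun h => ?_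
  rw [coprime_iff _ _ h]
  have : (|Denumerable.ofNat ℤ m.unpair.1|).toNat = (Denumerable.ofNat ℤ m.unpair.1).natAbs := by
    rcases abs_cases (Denumerable.ofNat ℤ m.unpair.1) with h | h <;> omega
  rw [this]
  refine forall_congr' fun x => forall_congr' fun _ => ?_
  tauto

theorem encode_rat_aux (q : ℚ) :
    @encode ℚ Rat.instEncodable q = Nat.pair (encode q.num) q.den := rfl

theorem mem_range_iff (m : ℕ) : m ∈ Set.range (@encode ℚ Rat.instEncodable) ↔ okc m := by
  constructor
  · rintro ⟨q, rfl⟩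
    rw [encode_rat_aux]
    simp only [okc, Nat.unpair_pair, Denumerable.ofNat_encode]
    exact ⟨q.pos, q.reduced⟩
  · rintro ⟨h1, h2⟩
    refine ⟨⟨Denumerable.ofNat ℤ m.unpair.1, m.unpair.2, h1.ne', h2⟩, ?_⟩
    rw [encode_rat_aux]
    simp only [Denumerable.encode_ofNat, Nat.pair_unpair]

theorem encode_rat (q : ℚ) [DecidablePred okc] : @encode ℚ Primcodable.toEncodable q =
    ((List.range (Nat.pair (encode q.num) q.den)).filter (fun x => decide (okc x))).length := by
  have h : @encode ℚ Primcodable.toEncodable q =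
      (List.range (@encode ℚ Rat.instEncodable q)).countP
      (fun x => @decide (x ∈ Set.range (@encode ℚ Rat.instEncodable))
        (@decidableRangeEncode ℚ Rat.instEncodable x)) := rfl
  rw [h, encode_rat_aux, List.countP_eq_length_filter]
  congr 2
  funext x
  rw [decide_eq_decide]
  exact mem_range_iff x

theorem rat_data : ∃ F : ℚ → ℤ × ℕ, Computable F ∧ ∀ q, F q = (q.num, q.den) := by
  classical
  have hlen : Primrec fun m : ℕ => ((List.range m).filter (fun x => decide (okc x))).length :=
    Primrec.list_length.comp ((Primrec.listFilter okc_pr).comp Primrec.list_range)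
  have hpair : Primrec fun p : ℚ × (ℤ × ℕ) => Nat.pair (encode p.2.1) p.2.2 :=
    Primrec₂.natPair.comp (Primrec.encode.comp (Primrec.fst.comp Primrec.snd))
      (Primrec.snd.comp Primrec.snd)
  obtain ⟨F, hF, hR⟩ := search (fun (q : ℚ) (p : ℤ × ℕ) => okc (Nat.pair (encode p.1) p.2) ∧
      @encode ℚ Primcodable.toEncodable q = ((List.range (Nat.pair (encode p.1) p.2)).filter
        (fun x => decide (okc x))).length)
    ((okc_pr.comp hpair).and (Primrec.eq.comp (Primrec.encode.comp Primrec.fst)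
      (hlen.comp hpair)))
    (fun q => ⟨(q.num, q.den), (mem_range_iff _).1 ⟨q, encode_rat_aux q⟩, encode_rat q⟩)
  refine ⟨F, hF, fun q => ?_⟩
  obtain ⟨⟨h1, h2⟩, h3⟩ := hR q
  simp only [Nat.unpair_pair, Denumerable.ofNat_encode] at h1 h2
  have h4 := encode_rat ⟨(F q).1, (F q).2, h1.ne', h2⟩
  simp only at h4
  rw [← h4] at h3
  have h5 := @encode_injective ℚ Primcodable.toEncodable _ _ h3
  have e1 := congrArg Rat.num h5
  have e2 := congrArg Rat.den h5
  exact Prod.ext e1.symm e2.symm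

end AlgCmp

namespace AlgCmp

open Polynomial

/-! ### Coefficient lists as polynomials -/

/-- The polynomial of a coefficient list. -/
noncomputable def toPoly : List ℤ → ℤ[X]
  | [] => 0
  | a :: l => C a + X * toPoly l

theorem intListEval_eq (l : List ℤ) (x : ℝ) : intListEval l x = aeval x (toPoly l) := by
  have key : ∀ (l : List ℤ) (k : ℕ), ((l.zipIdx k).map fun p => (p.1 : ℝ) * x ^ p.2).sum =
      x ^ k * aeval x (toPoly l) := by
    intro l
    induction l with
    | nil => intro k; simp [toPoly]
    | cons a l ih =>
      intro k
      simp only [List.zipIdx_cons, List.map_cons, List.sum_cons, ih, toPoly, map_add, map_mul,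
        aeval_X, aeval_C]
      simp
      ring
  have := key l 0
  simpa [intListEval] using this

theorem toPoly_surj (P : ℤ[X]) : ∃ l, toPoly l = P := by
  have key : ∀ (n : ℕ) (P : ℤ[X]), P.natDegree ≤ n → ∃ l, toPoly l = P := by
    intro n
    induction n with
    | zero =>
      intro P hP
      refine ⟨[P.coeff 0], ?_⟩
      rw [eq_C_of_natDegree_le_zero hP]
      simp [toPoly]
    | succ n ih =>
      intro P hP
      obtain ⟨l, hl⟩ := ih P.divX (by rw [natDegree_divX_eq_natDegree_tsub_one]; omega)
      refine ⟨P.coeff 0 :: l, ?_⟩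
      rw [toPoly, hl, add_comm]
      exact X_mul_divX_add P
  exact key _ P le_rfl

theorem toPoly_eq_zero {l : List ℤ} (h : toPoly l = 0) : ∀ a ∈ l, a = 0 := by
  induction l with
  | nil => simp
  | cons a l ih =>
    have h0 : a = 0 := by
      have := congrArg (fun P => coeff P 0) h
      simpa [toPoly] using this
    have h1 : toPoly l = 0 := by
      rw [toPoly, h0] at h
      simpa using h
    intro b hb
    rcases List.mem_cons.1 hb with rfl | hb
    · exact h0
    · exact ih h1 b hb

theorem natDegree_toPoly (l : List ℤ) : (toPoly l).natDegree ≤ l.length := by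
  induction l with
  | nil => simp [toPoly]
  | cons a l ih =>
    rw [toPoly, List.length_cons]
    refine (natDegree_add_le _ _).trans (max_le (by simp) ?_)
    refine natDegree_mul_le.trans ?_
    rw [natDegree_X]; omega

/-- Horner evaluation of the polynomial and of its derivative. -/
def dev (l : List ℤ) (x : ℤ) : ℤ × ℤ :=
  l.foldr (fun a vd => (a + x * vd.1, vd.1 + x * vd.2)) (0, 0)

theorem dev_eq (l : List ℤ) (x : ℤ) :
    dev l x = ((toPoly l).eval x, (derivative (toPoly l)).eval x) := by
  induction l with
  | nil => simp [dev, toPoly]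
  | cons a l ih =>
    have : dev (a :: l) x = (a + x * (dev l x).1, (dev l x).1 + x * (dev l x).2) := rfl
    rw [this, ih]
    simp [toPoly, derivative_mul]

/-- Homogenized evaluation at `i / D`. -/
def hev (l : List ℤ) (i D : ℤ) : ℤ × ℤ :=
  l.foldr (fun a vw => (a * D * vw.2 + i * vw.1, D * vw.2)) (0, 1)

theorem hev_eq (l : List ℤ) (i D : ℤ) (hD : D ≠ 0) : (hev l i D).2 = D ^ l.length ∧
    ((hev l i D).1 : ℝ) = (D : ℝ) ^ l.length * aeval ((i : ℝ) / D) (toPoly l) := by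
  induction l with
  | nil => simp [hev, toPoly]
  | cons a l ih =>
    have : hev (a :: l) i D =
      (a * D * (hev l i D).2 + i * (hev l i D).1, D * (hev l i D).2) := rfl
    rw [this]
    have hD' : (D : ℝ) ≠ 0 := by exact_mod_cast hD
    constructor
    · simp only [ih.1, List.length_cons]; ring
    · simp only [ih.1, List.length_cons, toPoly]
      push_cast
      rw [ih.2]
      simp only [map_add, map_mul, aeval_X, aeval_C]
      simp only [eq_intCast]
      field_simp
      ring

/-- Absolute values of the coefficients. -/
def absL (l : List ℤ) : List ℤ := l.map fun a => |a|

theorem bound (l : List ℤ) (M : ℤ) : ∀ x y : ℝ, |x| ≤ M → |y| ≤ M →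
    |aeval x (toPoly l)| ≤ ((dev (absL l) M).1 : ℝ) ∧
    |aeval x (toPoly l) - aeval y (toPoly l)| ≤ ((dev (absL l) M).2 : ℝ) * |x - y| := by
  intro x y hx hy
  induction l with
  | nil => simp [dev, toPoly, absL]
  | cons a l ih =>
    have : dev (absL (a :: l)) M = (|a| + M * (dev (absL l) M).1,
      (dev (absL l) M).1 + M * (dev (absL l) M).2) := rfl
    rw [this]
    simp only [toPoly, map_add, map_mul, aeval_X, aeval_C]
    generalize dev (absL l) M = w at ih
    generalize aeval x (toPoly l) = vx at ih
    generalize aeval y (toPoly l) = vy at ih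
    obtain ⟨h1, h2⟩ := ih
    have hM : (0 : ℝ) ≤ M := (abs_nonneg _).trans hx
    push_cast
    simp only [eq_intCast]
    constructor
    · refine (abs_add_le _ _).trans ?_
      rw [abs_mul]
      gcongr
    · have e : (a : ℝ) + x * vx - (a + y * vy) = (x - y) * vx + y * (vx - vy) := by ring
      rw [e]
      refine (abs_add_le _ _).trans ?_
      rw [abs_mul, abs_mul]
      have a1 : |x - y| * |vx| ≤ |x - y| * w.1 := by gcongr
      have a2 : |y| * |vx - vy| ≤ M * (w.2 * |x - y|) := by gcongr
      nlinarith

/-! ### Squarefree parts with certificates -/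

theorem common_den (w : ℚ[X]) : ∃ (K : ℤ) (W : ℤ[X]), K ≠ 0 ∧
    W.map (Int.castRingHom ℚ) = C (K : ℚ) * w := by
  obtain ⟨b, hb, h⟩ := IsLocalization.integerNormalization_spec (nonZeroDivisors ℤ) w
  refine ⟨b, IsLocalization.integerNormalization (nonZeroDivisors ℤ) w,
    nonZeroDivisors.ne_zero hb, ?_⟩
  have : algebraMap ℤ ℚ = Int.castRingHom ℚ := rfl
  rw [← this, h]
  ext n
  simp

theorem cert_exists (P : ℤ[X]) (hP : P ≠ 0) : ∃ (S A B U V : ℤ[X]) (n : ℕ) (K : ℤ), K ≠ 0 ∧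
    C K * P = S * U ∧ C K * S ^ n = P * V ∧ A * S + B * derivative S = C K := by
  classical
  set φ := Int.castRingHom ℚ with hφ0
  have hinj : Function.Injective φ := Int.cast_injective
  have hφ : ∀ z : ℤ, φ z = (z : ℚ) := fun _ => rfl
  have hP' : P.map φ ≠ 0 := (Polynomial.map_ne_zero_iff hinj).2 hP
  set T := UniqueFactorizationMonoid.radical (P.map φ) with hT
  obtain ⟨U0, hU0⟩ : T ∣ P.map φ := UniqueFactorizationMonoid.radical_dvd_self
  obtain ⟨n, V0, hV0⟩ := UniqueFactorizationMonoid.exists_dvd_radical_self_pow hP'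
  have hsq : Squarefree T := UniqueFactorizationMonoid.squarefree_radical
  have hsep : T.Separable := PerfectField.separable_iff_squarefree.2 hsq
  obtain ⟨a0, b0, hab⟩ := hsep
  obtain ⟨d, S, hd, hS⟩ := common_den T
  have hd' : (d : ℚ) ≠ 0 := by exact_mod_cast hd
  obtain ⟨k1, U, hk1, hU⟩ := common_den (C (d : ℚ)⁻¹ * U0)
  obtain ⟨k2, V, hk2, hV⟩ := common_den (C (d : ℚ) ^ n * V0)
  obtain ⟨k3, A, hk3, hA⟩ := common_den (C (d : ℚ)⁻¹ * a0)
  obtain ⟨k4, B, hk4, hB⟩ := common_den (C (d : ℚ)⁻¹ * b0)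
  rw [← hφ0] at hS hU hV hA hB
  rw [← hT] at hV0
  have hdd : C (d : ℚ) * C (d : ℚ)⁻¹ = 1 := by
    rw [← C_mul, mul_inv_cancel₀ hd', C_1]
  refine ⟨S, C (k1 * k2 * k4) * A, C (k1 * k2 * k3) * B, C (k2 * k3 * k4) * U,
    C (k1 * k3 * k4) * V, n, k1 * k2 * k3 * k4, by positivity, ?_, ?_, ?_⟩
  · apply Polynomial.map_injective φ hinj
    simp only [Polynomial.map_mul, Polynomial.map_C, hS, hU, hφ]
    push_cast
    simp only [C_mul]
    linear_combination (C (k1:ℚ) * C (k2:ℚ) * C (k3:ℚ) * C (k4:ℚ)) * hU0 -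
      (C (k1:ℚ) * C (k2:ℚ) * C (k3:ℚ) * C (k4:ℚ)) * T * U0 * hdd
  · apply Polynomial.map_injective φ hinj
    simp only [Polynomial.map_mul, Polynomial.map_pow, Polynomial.map_C, hS, hV, hφ]
    push_cast
    simp only [C_mul]
    linear_combination (C (k1:ℚ) * C (k2:ℚ) * C (k3:ℚ) * C (k4:ℚ)) * C (d : ℚ) ^ n * hV0
  · apply Polynomial.map_injective φ hinj
    simp only [Polynomial.map_mul, Polynomial.map_add, ← Polynomial.derivative_map,
      Polynomial.map_C, hS, hA, hB, hφ, derivative_C_mul]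
    push_cast
    simp only [C_mul]
    linear_combination (C (k1:ℚ) * C (k2:ℚ) * C (k3:ℚ) * C (k4:ℚ)) *
      (C (d : ℚ) * C (d : ℚ)⁻¹ * hab + hdd)

theorem eq_of_eval (P Q : ℤ[X]) (N : ℕ) (hP : P.natDegree < N) (hQ : Q.natDegree < N)
    (h : ∀ x < N, P.eval (x : ℤ) = Q.eval (x : ℤ)) : P = Q := by
  rw [← sub_eq_zero]
  refine eq_zero_of_natDegree_lt_card_of_eval_eq_zero (P - Q) (ι := Fin N)
    (f := fun i => ((i : ℕ) : ℤ)) ?_ ?_ ?_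
  · intro i j hij
    ext
    have : ((i : ℕ) : ℤ) = ((j : ℕ) : ℤ) := hij
    exact_mod_cast this
  · intro i
    rw [eval_sub, h i i.2, sub_self]
  · rw [Fintype.card_fin]
    exact (natDegree_sub_le _ _).trans_lt (max_lt hP hQ)

/-- Certificates: `s, A, B, u, v, n, K`. -/
abbrev Cert := List ℤ × List ℤ × List ℤ × List ℤ × List ℤ × ℕ × ℤ

/-- Number of test points. -/
def certN (p q : List ℤ) (c : Cert) : ℕ :=
  p.length + q.length + c.1.length * (c.2.2.2.2.2.1 + 2) + c.2.1.length + c.2.2.1.length +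
    c.2.2.2.1.length + c.2.2.2.2.1.length + 1

/-- The identities at a test point. -/
def certAt (p q : List ℤ) (c : Cert) (x : ℤ) : Prop :=
  (c.2.2.2.2.2.2 * ((dev p x).1 * (dev q x).1) = (dev c.1 x).1 * (dev c.2.2.2.1 x).1 ∧
  c.2.2.2.2.2.2 * (dev c.1 x).1 ^ c.2.2.2.2.2.1 =
    ((dev p x).1 * (dev q x).1) * (dev c.2.2.2.2.1 x).1) ∧
  (dev c.2.1 x).1 * (dev c.1 x).1 + (dev c.2.2.1 x).1 * (dev c.1 x).2 = c.2.2.2.2.2.2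

/-- The certificate relation. -/
def certRel (a : List ℤ × List ℤ) (c : Cert) : Prop :=
  (((∀ k ∈ a.1, k = 0) ∨ (∀ k ∈ a.2, k = 0)) ∨
    (¬ c.2.2.2.2.2.2 = 0 ∧ ∀ x < certN a.1 a.2 c, certAt a.1 a.2 c (x : ℤ)))

theorem dev_pr {α : Type} [Primcodable α] {f : α → List ℤ} {x : α → ℤ} (hf : Primrec f)
    (hx : Primrec x) : Primrec fun a => dev (f a) (x a) := by
  refine Primrec.list_foldr (h := fun a b => (b.1 + x a * b.2.1, b.2.1 + x a * b.2.2)) hf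
    (Primrec.const (0, 0)) ?_
  have h1 : Primrec fun p : α × ℤ × ℤ × ℤ => p.2.1 := Primrec.fst.comp Primrec.snd
  have h2 : Primrec fun p : α × ℤ × ℤ × ℤ => p.2.2.1 :=
    Primrec.fst.comp (Primrec.snd.comp Primrec.snd)
  have h3 : Primrec fun p : α × ℤ × ℤ × ℤ => p.2.2.2 :=
    Primrec.snd.comp (Primrec.snd.comp Primrec.snd)
  have h0 : Primrec fun p : α × ℤ × ℤ × ℤ => x p.1 := hx.comp Primrec.fst
  exact Primrec.pair (zadd h1 (zmul h0 h2)) (zadd h2 (zmul h0 h3))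

theorem hev_pr {α : Type} [Primcodable α] {f : α → List ℤ} {i D : α → ℤ} (hf : Primrec f)
    (hi : Primrec i) (hD : Primrec D) : Primrec fun a => hev (f a) (i a) (D a) := by
  refine Primrec.list_foldr
    (h := fun a b => (b.1 * D a * b.2.2 + i a * b.2.1, D a * b.2.2)) hf
    (Primrec.const (0, 1)) ?_
  have h1 : Primrec fun p : α × ℤ × ℤ × ℤ => p.2.1 := Primrec.fst.comp Primrec.snd
  have h2 : Primrec fun p : α × ℤ × ℤ × ℤ => p.2.2.1 :=
    Primrec.fst.comp (Primrec.snd.comp Primrec.snd)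
  have h3 : Primrec fun p : α × ℤ × ℤ × ℤ => p.2.2.2 :=
    Primrec.snd.comp (Primrec.snd.comp Primrec.snd)
  have h0 : Primrec fun p : α × ℤ × ℤ × ℤ => i p.1 := hi.comp Primrec.fst
  have h4 : Primrec fun p : α × ℤ × ℤ × ℤ => D p.1 := hD.comp Primrec.fst
  exact Primrec.pair (zadd (zmul (zmul h1 h4) h3) (zmul h0 h2)) (zmul h4 h3)

theorem absL_pr {α : Type} [Primcodable α] {f : α → List ℤ} (hf : Primrec f) :
    Primrec fun a => absL (f a) :=
  Primrec.list_map hf (zabs Primrec.snd).to₂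

theorem certRel_pr : PrimrecRel certRel := by
  have hz : PrimrecPred fun l : List ℤ => ∀ k ∈ l, k = 0 :=
    PrimrecPred.forall_mem_list (zeq Primrec.id (Primrec.const 0))
  let A := (List ℤ × List ℤ) × Cert
  have p : Primrec fun a : A => a.1.1 := Primrec.fst.comp Primrec.fst
  have q : Primrec fun a : A => a.1.2 := Primrec.snd.comp Primrec.fst
  have c0 : Primrec fun a : A => a.2 := Primrec.snd
  have s : Primrec fun a : A => a.2.1 := Primrec.fst.comp c0
  have c1 : Primrec fun a : A => a.2.2 := Primrec.snd.comp c0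
  have cA : Primrec fun a : A => a.2.2.1 := Primrec.fst.comp c1
  have c2 : Primrec fun a : A => a.2.2.2 := Primrec.snd.comp c1
  have cB : Primrec fun a : A => a.2.2.2.1 := Primrec.fst.comp c2
  have c3 : Primrec fun a : A => a.2.2.2.2 := Primrec.snd.comp c2
  have u : Primrec fun a : A => a.2.2.2.2.1 := Primrec.fst.comp c3
  have c4 : Primrec fun a : A => a.2.2.2.2.2 := Primrec.snd.comp c3
  have v : Primrec fun a : A => a.2.2.2.2.2.1 := Primrec.fst.comp c4
  have c5 : Primrec fun a : A => a.2.2.2.2.2.2 := Primrec.snd.comp c4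
  have n : Primrec fun a : A => a.2.2.2.2.2.2.1 := Primrec.fst.comp c5
  have K : Primrec fun a : A => a.2.2.2.2.2.2.2 := Primrec.snd.comp c5
  have len : ∀ {f : A → List ℤ}, Primrec f → Primrec fun a => (f a).length :=
    fun hf => Primrec.list_length.comp hf
  have hN : Primrec fun a : A => certN a.1.1 a.1.2 a.2 := by
    have nadd : ∀ {f g : A → ℕ}, Primrec f → Primrec g → Primrec fun a => f a + g a :=
      fun hf hg => Primrec.nat_add.comp hf hg
    exact nadd (nadd (nadd (nadd (nadd (nadd (nadd (len p) (len q))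
      (Primrec.nat_mul.comp (len s) (nadd n (Primrec.const 2)))) (len cA)) (len cB)) (len u))
      (len v)) (Primrec.const 1)
  have hat : PrimrecRel fun (a : A) (x : ℕ) => certAt a.1.1 a.1.2 a.2 (x : ℤ) := by
    have x : Primrec fun b : A × ℕ => (b.2 : ℤ) := zcast Primrec.snd
    have d : ∀ {f : A → List ℤ}, Primrec f → Primrec fun b : A × ℕ => dev (f b.1) (b.2 : ℤ) :=
      fun hf => dev_pr (hf.comp Primrec.fst) x
    have K' : Primrec fun b : A × ℕ => b.1.2.2.2.2.2.2.2 := K.comp Primrec.fst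
    have n' : Primrec fun b : A × ℕ => b.1.2.2.2.2.2.2.1 := n.comp Primrec.fst
    have pq := zmul (Primrec.fst.comp (d p)) (Primrec.fst.comp (d q))
    exact ((zeq (zmul K' pq) (zmul (Primrec.fst.comp (d s)) (Primrec.fst.comp (d u)))).and
      (zeq (zmul K' (zpow (Primrec.fst.comp (d s)) n')) (zmul pq (Primrec.fst.comp (d v))))).and
      (zeq (zadd (zmul (Primrec.fst.comp (d cA)) (Primrec.fst.comp (d s)))
        (zmul (Primrec.fst.comp (d cB)) (Primrec.snd.comp (d s)))) K')
  exact ((hz.comp p).or (hz.comp q)).or ((zeq K (Primrec.const 0)).not.and (pforall hat hN))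

theorem sqfree : ∃ F : List ℤ × List ℤ → List ℤ × List ℤ, Computable F ∧
    ∀ p q : List ℤ, (∃ k ∈ p, k ≠ 0) → (∃ k ∈ q, k ≠ 0) →
      ∃ (B U V : ℤ[X]) (n : ℕ) (K : ℤ), K ≠ 0 ∧
        C K * (toPoly p * toPoly q) = toPoly (F (p, q)).1 * U ∧
        C K * (toPoly (F (p, q)).1) ^ n = toPoly p * toPoly q * V ∧
        toPoly (F (p, q)).2 * toPoly (F (p, q)).1 + B * derivative (toPoly (F (p, q)).1) = C K := by
  obtain ⟨F, hF, hR⟩ := search certRel certRel_pr (by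
    rintro ⟨p, q⟩
    by_cases hp : toPoly p = 0
    · exact ⟨default, Or.inl (Or.inl (toPoly_eq_zero hp))⟩
    by_cases hq : toPoly q = 0
    · exact ⟨default, Or.inl (Or.inr (toPoly_eq_zero hq))⟩
    obtain ⟨S, A, B, U, V, n, K, hK, h1, h2, h3⟩ := cert_exists _ (mul_ne_zero hp hq)
    obtain ⟨s, rfl⟩ := toPoly_surj S
    obtain ⟨A, rfl⟩ := toPoly_surj A
    obtain ⟨B, rfl⟩ := toPoly_surj B
    obtain ⟨U, rfl⟩ := toPoly_surj U
    obtain ⟨V, rfl⟩ := toPoly_surj V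
    refine ⟨(s, A, B, U, V, n, K), Or.inr ⟨hK, fun x _ => ⟨⟨?_, ?_⟩, ?_⟩⟩⟩
    · simpa [dev_eq] using congrArg (eval (x : ℤ)) h1
    · simpa [dev_eq] using congrArg (eval (x : ℤ)) h2
    · simpa [dev_eq] using congrArg (eval (x : ℤ)) h3)
  refine ⟨fun a => ((F a).1, (F a).2.1),
    Computable.pair (Computable.fst.comp hF) (Computable.fst.comp (Computable.snd.comp hF)), ?_⟩
  rintro p q ⟨k1, hk1, hk1'⟩ ⟨k2, hk2, hk2'⟩
  rcases hR (p, q) with (h | h) | ⟨hK, h⟩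
  · exact absurd (h _ hk1) hk1'
  · exact absurd (h _ hk2) hk2'
  simp only at hK h ⊢
  generalize F (p, q) = c at hK h ⊢
  obtain ⟨s, A, B, u, v, n, K⟩ := c
  simp only [certAt, certN, dev_eq] at hK h
  have dp := natDegree_toPoly p
  have dq := natDegree_toPoly q
  have ds := natDegree_toPoly s
  have dA := natDegree_toPoly A
  have dB := natDegree_toPoly B
  have du := natDegree_toPoly u
  have dv := natDegree_toPoly v
  have ds' : (derivative (toPoly s)).natDegree ≤ s.length :=
    (natDegree_derivative_le _).trans (by omega)
  have dsn : ((toPoly s) ^ n).natDegree ≤ s.length * n := by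
    refine natDegree_pow_le.trans ?_
    rw [mul_comm]; gcongr
  have dm : ∀ {P Q : ℤ[X]} {a b : ℕ}, P.natDegree ≤ a → Q.natDegree ≤ b →
      (P * Q).natDegree ≤ a + b := fun h1 h2 => natDegree_mul_le.trans (add_le_add h1 h2)
  have dC : (C K).natDegree ≤ 0 := by simp
  refine ⟨toPoly B, toPoly u, toPoly v, n, K, hK, ?_, ?_, ?_⟩
  · refine eq_of_eval _ _ (p.length + q.length + s.length * (n + 2) + A.length + B.length +
      u.length + v.length + 1) ?_ ?_ fun x hx => ?_
    rotate_left 2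
    · simpa using (h x hx).1.1
    · refine lt_of_le_of_lt (dm dC (dm dp dq)) ?_
      nlinarith
    · refine lt_of_le_of_lt (dm ds du) ?_
      nlinarith
  · refine eq_of_eval _ _ (p.length + q.length + s.length * (n + 2) + A.length + B.length +
      u.length + v.length + 1) ?_ ?_ fun x hx => ?_
    rotate_left 2
    · simpa using (h x hx).1.2
    · refine lt_of_le_of_lt (dm dC dsn) ?_
      nlinarith
    · refine lt_of_le_of_lt (dm (dm dp dq) dv) ?_
      nlinarith
  · refine eq_of_eval _ _ (p.length + q.length + s.length * (n + 2) + A.length + B.length +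
      u.length + v.length + 1) ?_ ?_ fun x hx => ?_
    rotate_left 2
    · simpa using (h x hx).2
    · refine lt_of_le_of_lt ((natDegree_add_le _ _).trans (max_le_add_of_nonneg (Nat.zero_le _) (Nat.zero_le _)))
        (lt_of_le_of_lt (add_le_add (dm dA ds) (dm dB ds')) ?_)
      nlinarith
    · refine lt_of_le_of_lt dC ?_
      positivity

end AlgCmp

namespace AlgCmp

open Polynomial

/-! ### Root facts -/

theorem sq_root {P S A B U V : ℤ[X]} {n : ℕ} {K : ℤ} (hK : K ≠ 0) (h1 : C K * P = S * U)
    (h2 : C K * S ^ n = P * V) (h3 : A * S + B * derivative S = C K) (x : ℝ) :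
    (aeval x S = 0 ↔ aeval x P = 0) ∧ (aeval x S = 0 → aeval x (derivative S) ≠ 0) := by
  have hK' : (K : ℝ) ≠ 0 := by exact_mod_cast hK
  have g1 := congrArg (aeval x) h1
  have g2 := congrArg (aeval x) h2
  have g3 := congrArg (aeval x) h3
  simp only [map_mul, map_add, map_pow, eq_intCast, map_intCast] at g1 g2 g3
  refine ⟨⟨fun h => ?_, fun h => ?_⟩, fun h h' => ?_⟩
  · rw [h, zero_mul] at g1
    exact (mul_eq_zero.1 g1).resolve_left hK'
  · rw [h, zero_mul] at g2
    by_contra hne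
    exact pow_ne_zero n hne ((mul_eq_zero.1 g2).resolve_left hK')
  · rw [h, h'] at g3
    apply hK'
    rw [← g3]; ring

theorem separation {s A : List ℤ} {B : ℤ[X]} {K : ℤ} (hK : K ≠ 0)
    (h3 : toPoly A * toPoly s + B * derivative (toPoly s) = C K) (M : ℤ) (x y : ℝ)
    (hxy : x < y) (hx : |x| ≤ M) (hy : |y| ≤ M) (sx : aeval x (toPoly s) = 0)
    (sy : aeval y (toPoly s) = 0) :
    1 ≤ (((dev (absL A) M).1 * (dev (absL s) M).2 : ℤ) : ℝ) * (y - x) := by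
  obtain ⟨z, hz, hz'⟩ := exists_deriv_eq_zero (f := fun t : ℝ => aeval t (toPoly s)) hxy
    (Polynomial.continuous_aeval _).continuousOn (by rw [sx, sy])
  rw [Polynomial.deriv_aeval] at hz'
  have hzM : |z| ≤ M := by
    rw [abs_le] at *
    constructor <;> linarith [hz.1, hz.2]
  have g3 := congrArg (aeval z) h3
  simp only [map_mul, map_add, eq_intCast, map_intCast, hz', mul_zero, add_zero] at g3
  have b1 := (bound A M z x hzM hx).1
  have b2 := (bound s M z x hzM hx).2
  have b3 := (bound s M y x hy hx).2
  rw [sx, sub_zero] at b2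
  have hK1 : (1 : ℝ) ≤ |(K : ℝ)| := by
    exact_mod_cast Int.one_le_abs hK
  rw [← g3, abs_mul] at hK1
  have hL : (0 : ℝ) ≤ ((dev (absL s) M).2 : ℝ) := by
    have : 0 ≤ ((dev (absL s) M).2 : ℝ) * |y - x| := (abs_nonneg _).trans b3
    rw [abs_of_pos (sub_pos.2 hxy)] at this
    exact nonneg_of_mul_nonneg_left this (sub_pos.2 hxy)
  have hzx : |z - x| ≤ y - x := by
    rw [abs_of_pos (sub_pos.2 hz.1)]; linarith [hz.2]
  have hA : (0 : ℝ) ≤ ((dev (absL A) M).1 : ℝ) := (abs_nonneg _).trans b1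
  push_cast
  calc (1 : ℝ) ≤ _ := hK1
    _ ≤ ((dev (absL A) M).1 : ℝ) * (((dev (absL s) M).2 : ℝ) * |z - x|) := by gcongr
    _ ≤ ((dev (absL A) M).1 : ℝ) * (((dev (absL s) M).2 : ℝ) * (y - x)) := by gcongr
    _ = _ := by ring

theorem ivt {f : ℝ → ℝ} (hf : Continuous f) {x y : ℝ} (hxy : x < y) (h : f x * f y < 0) :
    ∃ z, x < z ∧ z < y ∧ f z = 0 := by
  rcases mul_neg_iff.1 h with ⟨h1, h2⟩ | ⟨h1, h2⟩
  · obtain ⟨z, hz, hz'⟩ := intermediate_value_Ioo' hxy.le hf.continuousOn ⟨h2, h1⟩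
    exact ⟨z, hz.1, hz.2, hz'⟩
  · obtain ⟨z, hz, hz'⟩ := intermediate_value_Ioo hxy.le hf.continuousOn ⟨h1, h2⟩
    exact ⟨z, hz.1, hz.2, hz'⟩

theorem sign_change (S : ℤ[X]) (r : ℝ) (hr : aeval r S = 0) (hr' : aeval r (derivative S) ≠ 0)
    {x y : ℝ} (hx : x < r) (hy : r < y) (hu : ∀ z, x ≤ z → z ≤ y → aeval z S = 0 → z = r) :
    (aeval x S : ℝ) * aeval y S < 0 := by
  have hm : ∀ z : ℝ, aeval z S = (S.map (Int.castRingHom ℝ)).eval z := by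
    intro z
    rw [eval_map, aeval_def]; rfl
  obtain ⟨G, hG⟩ : X - C r ∣ S.map (Int.castRingHom ℝ) := by
    rw [dvd_iff_isRoot, IsRoot, ← hm, hr]
  have hS : ∀ z : ℝ, aeval z S = (z - r) * G.eval z := by
    intro z
    rw [hm, hG]; simp
  have hGr : G.eval r ≠ 0 := by
    have : aeval r (derivative S) = ((derivative S).map (Int.castRingHom ℝ)).eval r := by
      rw [eval_map, aeval_def]; rfl
    rw [this, ← derivative_map, hG] at hr'
    simpa [derivative_mul] using hr'
  have hG0 : ∀ z, x ≤ z → z ≤ y → G.eval z ≠ 0 := by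
    intro z h1 h2 h3
    have := hu z h1 h2 (by rw [hS, h3, mul_zero])
    rw [this] at h3
    exact hGr h3
  have hxy := hx.trans hy
  have hpos : 0 < G.eval x * G.eval y := by
    by_contra hcon
    rcases lt_or_eq_of_le (not_lt.1 hcon) with h | h
    · obtain ⟨z, h1, h2, h3⟩ := ivt G.continuous hxy h
      exact hG0 z h1.le h2.le h3
    · rcases mul_eq_zero.1 h with h | h
      · exact hG0 x le_rfl hxy.le h
      · exact hG0 y hxy.le le_rfl h
  rw [hS, hS]
  have : (x - r) * (y - r) < 0 := mul_neg_of_neg_of_pos (by linarith) (by linarith)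
  nlinarith

/-! ### Locating a root on a grid -/

/-- A root has been found in the `n`-th cell. -/
def cond (a : List ℤ × ℤ × ℤ × ℤ) (n : ℕ) : Prop :=
  a.2.1 + n ≤ a.2.2.1 ∧ ((hev a.1 (a.2.1 + n) a.2.2.2).1 = 0 ∨
    (a.2.1 + n < a.2.2.1 ∧
      (hev a.1 (a.2.1 + n) a.2.2.2).1 * (hev a.1 (a.2.1 + n + 1) a.2.2.2).1 < 0))

/-- The search relation. -/
def locRel (a : List ℤ × ℤ × ℤ × ℤ) (n : ℕ) : Prop :=
  cond a n ∨ ∀ m < (a.2.2.1 + -a.2.1).toNat + 1, ¬ cond a m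

theorem cond_pr : PrimrecRel cond := by
  let T := (List ℤ × ℤ × ℤ × ℤ) × ℕ
  have s : Primrec fun a : T => a.1.1 := Primrec.fst.comp Primrec.fst
  have lo : Primrec fun a : T => a.1.2.1 :=
    Primrec.fst.comp (Primrec.snd.comp Primrec.fst)
  have hi : Primrec fun a : T => a.1.2.2.1 :=
    Primrec.fst.comp (Primrec.snd.comp (Primrec.snd.comp Primrec.fst))
  have D : Primrec fun a : T => a.1.2.2.2 :=
    Primrec.snd.comp (Primrec.snd.comp (Primrec.snd.comp Primrec.fst))
  have n : Primrec fun a : T => (a.2 : ℤ) := zcast Primrec.snd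
  have i := zadd lo n
  have h1 := Primrec.fst.comp (hev_pr s i D)
  have h2 := Primrec.fst.comp (hev_pr s (zadd i (Primrec.const 1)) D)
  exact (zle i hi).and ((zeq h1 (Primrec.const 0)).or
    ((zlt i hi).and (zlt (zmul h1 h2) (Primrec.const 0))))

theorem locRel_pr : PrimrecRel locRel := by
  let T := (List ℤ × ℤ × ℤ × ℤ) × ℕ
  have lo : Primrec fun a : T => a.1.2.1 :=
    Primrec.fst.comp (Primrec.snd.comp Primrec.fst)
  have hi : Primrec fun a : T => a.1.2.2.1 :=
    Primrec.fst.comp (Primrec.snd.comp (Primrec.snd.comp Primrec.fst))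
  have hn : Primrec fun a : T => (a.1.2.2.1 + -a.1.2.1).toNat + 1 :=
    Primrec.succ.comp (toNat_pr.comp (zadd hi (zneg lo)))
  have hc : PrimrecRel fun (a : T) (m : ℕ) => ¬ cond a.1 m :=
    (cond_pr.comp (Primrec.fst.comp Primrec.fst) Primrec.snd).not
  exact PrimrecPred.or cond_pr (pforall hc hn)

theorem loc_correct (s : List ℤ) (lo hi D : ℤ) (hD : 0 < D) (r : ℝ) (h1 : (lo : ℝ) / D ≤ r)
    (h2 : r ≤ (hi : ℝ) / D) (hr : aeval r (toPoly s) = 0)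
    (hr' : aeval r (derivative (toPoly s)) ≠ 0)
    (hu : ∀ z : ℝ, (lo : ℝ) / D ≤ z → z ≤ (hi : ℝ) / D → aeval z (toPoly s) = 0 → z = r)
    (n : ℕ) (hn : locRel (s, lo, hi, D) n) : lo + n = ⌊r * D⌋ := by
  have hD' : (0 : ℝ) < D := by exact_mod_cast hD
  have hH := fun i => (hev_eq s i D hD.ne').2
  have hpow : (0 : ℝ) < (D : ℝ) ^ s.length := by positivity
  have hH0 : ∀ i, (hev s i D).1 = 0 ↔ aeval ((i : ℝ) / D) (toPoly s) = 0 := by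
    intro i
    rw [← Int.cast_eq_zero (α := ℝ), hH, mul_eq_zero]
    simp [hpow.ne']
  have hHn : ∀ i, (hev s i D).1 * (hev s (i + 1) D).1 < 0 ↔
      (aeval ((i : ℝ) / D) (toPoly s) : ℝ) * aeval (((i + 1 : ℤ) : ℝ) / D) (toPoly s) < 0 := by
    intro i
    rw [← Int.cast_lt_zero (R := ℝ), Int.cast_mul, hH, hH, mul_mul_mul_comm]
    have hp2 := mul_pos hpow hpow
    refine ⟨fun h => ?_, fun h => mul_neg_of_pos_of_neg hp2 h⟩
    by_contra hb
    exact absurd h (not_lt.2 (mul_nonneg hp2.le (not_lt.1 hb)))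
  have hdiv : ∀ i j : ℤ, i ≤ j → (i : ℝ) / D ≤ (j : ℝ) / D := by
    intro i j hij
    have : (i : ℝ) ≤ j := by exact_mod_cast hij
    gcongr
  -- soundness
  have sound : ∀ m : ℕ, cond (s, lo, hi, D) m → lo + m = ⌊r * D⌋ := by
    rintro m ⟨hm, hc⟩
    simp only at hm hc
    have hlo : lo ≤ lo + m := by omega
    generalize lo + (m : ℤ) = j at hm hc hlo ⊢
    rcases hc with hc | ⟨hlt, hc⟩
    · have := hu _ (hdiv _ _ hlo) (hdiv _ _ hm) ((hH0 j).1 hc)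
      rw [← this, div_mul_cancel₀ _ hD'.ne', Int.floor_intCast]
    · have hlt' : (j : ℝ) / D < ((j + 1 : ℤ) : ℝ) / D := by
        have : (j : ℝ) < ((j + 1 : ℤ) : ℝ) := by push_cast; linarith
        gcongr
      obtain ⟨z, z1, z2, z3⟩ := ivt (f := fun t : ℝ => aeval t (toPoly s))
        (Polynomial.continuous_aeval _) hlt' ((hHn j).1 hc)
      have := hu z ((hdiv _ _ hlo).trans z1.le) (z2.le.trans (hdiv _ _ hlt)) z3
      rw [← this]
      symm
      rw [Int.floor_eq_iff]
      rw [div_lt_iff₀ hD'] at z1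
      rw [lt_div_iff₀ hD'] at z2
      push_cast at z2
      exact ⟨z1.le, z2⟩
  rcases hn with hn | hn
  · exact sound n hn
  exfalso
  rw [div_le_iff₀ hD'] at h1
  rw [le_div_iff₀ hD'] at h2
  have hlo : lo ≤ ⌊r * D⌋ := Int.le_floor.2 h1
  have hhi : ⌊r * D⌋ ≤ hi := by
    have := (Int.floor_le (r * D)).trans h2
    exact_mod_cast this
  obtain ⟨m, hm⟩ := Int.eq_ofNat_of_zero_le (sub_nonneg.2 hlo)
  refine hn m (by simp only; omega) ?_
  have hm' : lo + (m : ℤ) = ⌊r * D⌋ := by omega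
  have f1 := Int.floor_le (r * D)
  have f2 := Int.lt_floor_add_one (r * D)
  unfold cond
  simp only [hm']
  generalize ⌊r * D⌋ = i at hlo hhi f1 f2 ⊢
  refine ⟨hhi, ?_⟩
  rw [hH0, hHn]
  rcases eq_or_lt_of_le f1 with h | h
  · left
    rw [h, mul_div_cancel_right₀ _ hD'.ne', hr]
  · right
    have hlt : i < hi := by exact_mod_cast h.trans_le h2
    refine ⟨hlt, sign_change _ r hr hr' ?_ ?_ ?_⟩
    · rwa [div_lt_iff₀ hD']
    · rw [lt_div_iff₀ hD']; push_cast; exact f2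
    · intro z z1 z2 z3
      exact hu z ((hdiv _ _ hlo).trans z1) (z2.trans (hdiv _ _ hlt)) z3

theorem loc : ∃ L : List ℤ × ℤ × ℤ × ℤ → ℕ, Computable L ∧ ∀ a, locRel a (L a) := by
  classical
  refine search locRel locRel_pr fun a => ?_
  by_cases h : ∃ n, cond a n
  · obtain ⟨n, hn⟩ := h
    exact ⟨n, Or.inl hn⟩
  · exact ⟨0, Or.inr fun m _ hm => h ⟨m, hm⟩⟩

end AlgCmp

namespace AlgCmp

open Polynomial

/-! ### Assembly -/

/-- Preprocessed data: squarefree parts, separation data, numerators and denominators. -/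
abbrev Pre := (List ℤ × List ℤ × List ℤ × List ℤ) × ((ℤ × ℕ) × ℤ × ℕ) × ((ℤ × ℕ) × ℤ × ℕ)

/-- Bound for the roots. -/
def bdM (y : Pre) : ℤ := |y.2.1.1.1| + |y.2.1.2.1| + (|y.2.2.1.1| + |y.2.2.2.1|)

/-- Separation constant. -/
def sepE (y : Pre) : ℤ := (dev (absL y.1.2.2.2) (bdM y)).1 * (dev (absL y.1.2.2.1) (bdM y)).2

/-- Positive multiplier. -/
def scl (y : Pre) : ℤ := |sepE y| + 1

/-- Grid denominator. -/
def grid (y : Pre) : ℤ :=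
  ((y.2.1.1.2 : ℤ) * (y.2.1.2.2 : ℤ)) * ((y.2.2.1.2 : ℤ) * (y.2.2.2.2 : ℤ)) * scl y

/-- First location problem. -/
def arg1 (y : Pre) : List ℤ × ℤ × ℤ × ℤ :=
  (y.1.1, y.2.1.1.1 * (y.2.1.2.2 : ℤ) * ((y.2.2.1.2 : ℤ) * (y.2.2.2.2 : ℤ)) * scl y,
    y.2.1.2.1 * (y.2.1.1.2 : ℤ) * ((y.2.2.1.2 : ℤ) * (y.2.2.2.2 : ℤ)) * scl y, grid y)

/-- Second location problem. -/
def arg2 (y : Pre) : List ℤ × ℤ × ℤ × ℤ :=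
  (y.1.2.1, y.2.2.1.1 * (y.2.2.2.2 : ℤ) * ((y.2.1.1.2 : ℤ) * (y.2.1.2.2 : ℤ)) * scl y,
    y.2.2.2.1 * (y.2.2.1.2 : ℤ) * ((y.2.1.1.2 : ℤ) * (y.2.1.2.2 : ℤ)) * scl y, grid y)

theorem arg_pr : Primrec arg1 ∧ Primrec arg2 := by
  have l : Primrec fun y : Pre => y.1 := Primrec.fst
  have l1 : Primrec fun y : Pre => y.1.1 := Primrec.fst.comp l
  have l2 : Primrec fun y : Pre => y.1.2.1 := Primrec.fst.comp (Primrec.snd.comp l)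
  have l3 : Primrec fun y : Pre => y.1.2.2.1 :=
    Primrec.fst.comp (Primrec.snd.comp (Primrec.snd.comp l))
  have l4 : Primrec fun y : Pre => y.1.2.2.2 :=
    Primrec.snd.comp (Primrec.snd.comp (Primrec.snd.comp l))
  have r1 : Primrec fun y : Pre => y.2.1 := Primrec.fst.comp Primrec.snd
  have r2 : Primrec fun y : Pre => y.2.2 := Primrec.snd.comp Primrec.snd
  have n1 : Primrec fun y : Pre => y.2.1.1.1 := Primrec.fst.comp (Primrec.fst.comp r1)
  have d1 : Primrec fun y : Pre => (y.2.1.1.2 : ℤ) :=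
    zcast (Primrec.snd.comp (Primrec.fst.comp r1))
  have n2 : Primrec fun y : Pre => y.2.1.2.1 := Primrec.fst.comp (Primrec.snd.comp r1)
  have d2 : Primrec fun y : Pre => (y.2.1.2.2 : ℤ) :=
    zcast (Primrec.snd.comp (Primrec.snd.comp r1))
  have n3 : Primrec fun y : Pre => y.2.2.1.1 := Primrec.fst.comp (Primrec.fst.comp r2)
  have d3 : Primrec fun y : Pre => (y.2.2.1.2 : ℤ) :=
    zcast (Primrec.snd.comp (Primrec.fst.comp r2))
  have n4 : Primrec fun y : Pre => y.2.2.2.1 := Primrec.fst.comp (Primrec.snd.comp r2)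
  have d4 : Primrec fun y : Pre => (y.2.2.2.2 : ℤ) :=
    zcast (Primrec.snd.comp (Primrec.snd.comp r2))
  have hM : Primrec bdM := zadd (zadd (zabs n1) (zabs n2)) (zadd (zabs n3) (zabs n4))
  have hE : Primrec sepE := zmul (Primrec.fst.comp (dev_pr (absL_pr l4) hM))
    (Primrec.snd.comp (dev_pr (absL_pr l3) hM))
  have hs : Primrec scl := zadd (zabs hE) (Primrec.const 1)
  have hg : Primrec grid := zmul (zmul (zmul d1 d2) (zmul d3 d4)) hs
  exact ⟨l1.pair ((zmul (zmul (zmul n1 d2) (zmul d3 d4)) hs).pair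
      ((zmul (zmul (zmul n2 d1) (zmul d3 d4)) hs).pair hg)),
    l2.pair ((zmul (zmul (zmul n3 d4) (zmul d1 d2)) hs).pair
      ((zmul (zmul (zmul n4 d3) (zmul d1 d2)) hs).pair hg))⟩

theorem abs_rat_le (q : ℚ) : |(q : ℝ)| ≤ ((|q.num| : ℤ) : ℝ) := by
  have h : (q : ℝ) = (q.num : ℝ) / (q.den : ℝ) := by exact_mod_cast (Rat.num_div_den q).symm
  have hd : (1 : ℝ) ≤ (q.den : ℝ) := by exact_mod_cast q.pos
  rw [h, abs_div, abs_of_pos (by linarith : (0 : ℝ) < (q.den : ℝ)), Int.cast_abs]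
  exact div_le_self (abs_nonneg _) hd

theorem abs_le_of_Icc {b c : ℚ} {r : ℝ} (h : r ∈ Set.Icc (b : ℝ) (c : ℝ)) :
    |r| ≤ ((|b.num| + |c.num| : ℤ) : ℝ) := by
  have h1 := abs_rat_le b
  have h2 := abs_rat_le c
  have h3 : (0 : ℝ) ≤ ((|b.num| : ℤ) : ℝ) := by exact_mod_cast abs_nonneg _
  have h4 : (0 : ℝ) ≤ ((|c.num| : ℤ) : ℝ) := by exact_mod_cast abs_nonneg _
  rw [abs_le] at h1 h2 ⊢
  rw [Int.cast_add]
  constructor <;> linarith [h.1, h.2]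

theorem scaled (b : ℚ) (k D : ℤ) (hk : 0 < k) (hD : D = b.den * k) :
    ((b.num * k : ℤ) : ℝ) / (D : ℝ) = (b : ℝ) := by
  have h : (b : ℝ) = (b.num : ℝ) / (b.den : ℝ) := by exact_mod_cast (Rat.num_div_den b).symm
  have hd : (b.den : ℝ) ≠ 0 := by exact_mod_cast b.den_nz
  have hk' : (k : ℝ) ≠ 0 := by exact_mod_cast hk.ne'
  rw [h, hD]
  push_cast
  field_simp

theorem floor_cmp (x y : ℝ) (D : ℤ) (hD : 0 < D) (h : y < x → 1 ≤ (D : ℝ) * (x - y)) :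
    ⌊x * D⌋ ≤ ⌊y * D⌋ ↔ x ≤ y := by
  have hD' : (0 : ℝ) < D := by exact_mod_cast hD
  refine ⟨fun hf => ?_, fun hxy => Int.floor_le_floor (by gcongr)⟩
  by_contra hcon
  have h1 := h (not_le.1 hcon)
  have h2 := Int.lt_floor_add_one (x * D)
  have h3 := Int.floor_le (y * D)
  have h4 : ((⌊x * D⌋ : ℤ) : ℝ) ≤ ((⌊y * D⌋ : ℤ) : ℝ) := by exact_mod_cast hf
  linarith

end AlgCmp

/-- Order comparison of real algebraic numbers, each given by an integer
polynomial together with an isolating rational interval, is computable. -/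
theorem computable_order_comparison_real_algebraic :
    ∃ g : (List ℤ × ℚ × ℚ) × (List ℤ × ℚ × ℚ) → Bool, Computable g ∧
      ∀ c₁ c₂ : List ℤ × ℚ × ℚ, AlgCodeValid c₁ → AlgCodeValid c₂ →
        ∀ α α' : ℝ,
          (α ∈ Set.Icc (c₁.2.1 : ℝ) (c₁.2.2 : ℝ) ∧ intListEval c₁.1 α = 0) →
          (α' ∈ Set.Icc (c₂.2.1 : ℝ) (c₂.2.2 : ℝ) ∧ intListEval c₂.1 α' = 0) →
          (g (c₁, c₂) = true ↔ α ≤ α') := by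
  classical
  obtain ⟨F, hF, hFs⟩ := AlgCmp.sqfree
  obtain ⟨R, hR, hRs⟩ := AlgCmp.rat_data
  obtain ⟨L, hL, hLs⟩ := AlgCmp.loc
  let pre : (List ℤ × ℚ × ℚ) × (List ℤ × ℚ × ℚ) → AlgCmp.Pre := fun c =>
    (((F (c.1.1, [1])).1, (F (c.2.1, [1])).1, F (c.1.1, c.2.1)),
      (R c.1.2.1, R c.1.2.2), (R c.2.2.1, R c.2.2.2))
  have hpre : Computable pre := by
    let T := (List ℤ × ℚ × ℚ) × (List ℤ × ℚ × ℚ)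
    have p1 : Computable fun c : T => c.1.1 := Computable.fst.comp Computable.fst
    have p2 : Computable fun c : T => c.2.1 := Computable.fst.comp Computable.snd
    have b1 : Computable fun c : T => c.1.2.1 :=
      Computable.fst.comp (Computable.snd.comp Computable.fst)
    have b2 : Computable fun c : T => c.1.2.2 :=
      Computable.snd.comp (Computable.snd.comp Computable.fst)
    have b3 : Computable fun c : T => c.2.2.1 :=
      Computable.fst.comp (Computable.snd.comp Computable.snd)
    have b4 : Computable fun c : T => c.2.2.2 :=
      Computable.snd.comp (Computable.snd.comp Computable.snd)
    exact ((Computable.fst.comp (hF.comp (p1.pair (Computable.const [1])))).pair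
      ((Computable.fst.comp (hF.comp (p2.pair (Computable.const [1])))).pair
        (hF.comp (p1.pair p2)))).pair
      (((hR.comp b1).pair (hR.comp b2)).pair ((hR.comp b3).pair (hR.comp b4)))
  have hcmp : Primrec fun z : (ℤ × ℕ) × (ℤ × ℕ) =>
      decide (z.1.1 + (z.1.2 : ℤ) ≤ z.2.1 + (z.2.2 : ℤ)) :=
    (AlgCmp.zle
      (AlgCmp.zadd (Primrec.fst.comp Primrec.fst)
        (AlgCmp.zcast (Primrec.snd.comp Primrec.fst)))
      (AlgCmp.zadd (Primrec.fst.comp Primrec.snd)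
        (AlgCmp.zcast (Primrec.snd.comp Primrec.snd)))).decide
  have ha1 : Computable fun c => AlgCmp.arg1 (pre c) := AlgCmp.arg_pr.1.to_comp.comp hpre
  have ha2 : Computable fun c => AlgCmp.arg2 (pre c) := AlgCmp.arg_pr.2.to_comp.comp hpre
  have hlo1 := Computable.fst.comp (Computable.snd.comp ha1)
  have hlo2 := Computable.fst.comp (Computable.snd.comp ha2)
  refine ⟨_, hcmp.to_comp.comp ((hlo1.pair (hL.comp ha1)).pair (hlo2.pair (hL.comp ha2))), ?_⟩
  rintro ⟨p, b, c⟩ ⟨q, b', c'⟩ ⟨hp, hup⟩ ⟨hq, huq⟩ α α' ⟨hα, hpα⟩ ⟨hα', hqα⟩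
  simp only at hp hup hq huq hα hpα hα' hqα
  have hone : ∃ k ∈ [(1 : ℤ)], k ≠ 0 := ⟨1, by simp, one_ne_zero⟩
  have hone' : AlgCmp.toPoly [(1 : ℤ)] = 1 := by simp [AlgCmp.toPoly]
  obtain ⟨B1, U1, V1, m1, K1, hK1, e1, e2, e3⟩ := hFs p [1] hp hone
  obtain ⟨B2, U2, V2, m2, K2, hK2, f1, f2, f3⟩ := hFs q [1] hq hone
  obtain ⟨B3, U3, V3, m3, K3, hK3, g1, g2, g3⟩ := hFs p q hp hq
  rw [hone', mul_one] at e1 e2 f1 f2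
  have s1 := AlgCmp.sq_root hK1 e1 e2 e3
  have s2 := AlgCmp.sq_root hK2 f1 f2 f3
  have s3 := AlgCmp.sq_root hK3 g1 g2 g3
  rw [AlgCmp.intListEval_eq] at hpα hqα
  set y := pre ((p, b, c), (q, b', c')) with hy
  have hscl : 0 < AlgCmp.scl y := by
    have := abs_nonneg (AlgCmp.sepE y)
    unfold AlgCmp.scl; omega
  have hd : ∀ r : ℚ, (0 : ℤ) < (r.den : ℤ) := fun r => by exact_mod_cast r.pos
  have yb : y.2 = (((b.num, b.den), (c.num, c.den)), ((b'.num, b'.den), (c'.num, c'.den))) := by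
    simp [hy, pre, hRs]
  have hgrid : AlgCmp.grid y =
      ((b.den : ℤ) * c.den) * ((b'.den : ℤ) * c'.den) * AlgCmp.scl y := by
    simp [AlgCmp.grid, yb]
  have hgpos : 0 < AlgCmp.grid y := by
    rw [hgrid]
    have := hd b; have := hd c; have := hd b'; have := hd c'
    positivity
  have a1 : AlgCmp.arg1 y = ((F (p, [1])).1,
      b.num * ((c.den : ℤ) * ((b'.den : ℤ) * c'.den) * AlgCmp.scl y),
      c.num * ((b.den : ℤ) * ((b'.den : ℤ) * c'.den) * AlgCmp.scl y), AlgCmp.grid y) := by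
    have : y.1.1 = (F (p, [1])).1 := rfl
    simp [AlgCmp.arg1, yb, this, mul_assoc]
  have a2 : AlgCmp.arg2 y = ((F (q, [1])).1,
      b'.num * ((c'.den : ℤ) * ((b.den : ℤ) * c.den) * AlgCmp.scl y),
      c'.num * ((b'.den : ℤ) * ((b.den : ℤ) * c.den) * AlgCmp.scl y), AlgCmp.grid y) := by
    have : y.1.2.1 = (F (q, [1])).1 := rfl
    simp [AlgCmp.arg2, yb, this, mul_assoc]
  have kpos : ∀ u v w : ℚ, 0 < (u.den : ℤ) * ((v.den : ℤ) * w.den) * AlgCmp.scl y := by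
    intro u v w
    have := hd u; have := hd v; have := hd w
    positivity
  have r1 := hLs (AlgCmp.arg1 y)
  have r2 := hLs (AlgCmp.arg2 y)
  have i1 : (AlgCmp.arg1 y).2.1 + (L (AlgCmp.arg1 y) : ℤ) = ⌊α * AlgCmp.grid y⌋ := by
    generalize L (AlgCmp.arg1 y) = n at r1 ⊢
    rw [a1] at r1 ⊢
    have E1 := AlgCmp.scaled b _ (AlgCmp.grid y) (kpos c b' c') (by rw [hgrid]; ring)
    have E2 := AlgCmp.scaled c _ (AlgCmp.grid y) (kpos b b' c') (by rw [hgrid]; ring)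
    refine AlgCmp.loc_correct _ _ _ _ hgpos α ?_ ?_ ((s1 α).1.2 hpα)
      ((s1 α).2 ((s1 α).1.2 hpα)) ?_ n r1
    · rw [E1]; exact hα.1
    · rw [E2]; exact hα.2
    · intro z z1 z2 z3
      rw [E1] at z1
      rw [E2] at z2
      refine hup.unique ⟨⟨z1, z2⟩, ?_⟩ ⟨hα, ?_⟩
      · rw [AlgCmp.intListEval_eq]; exact (s1 z).1.1 z3
      · rw [AlgCmp.intListEval_eq]; exact hpα
  have i2 : (AlgCmp.arg2 y).2.1 + (L (AlgCmp.arg2 y) : ℤ) = ⌊α' * AlgCmp.grid y⌋ := by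
    generalize L (AlgCmp.arg2 y) = n at r2 ⊢
    rw [a2] at r2 ⊢
    have E1 := AlgCmp.scaled b' _ (AlgCmp.grid y) (kpos c' b c) (by rw [hgrid]; ring)
    have E2 := AlgCmp.scaled c' _ (AlgCmp.grid y) (kpos b' b c) (by rw [hgrid]; ring)
    refine AlgCmp.loc_correct _ _ _ _ hgpos α' ?_ ?_ ((s2 α').1.2 hqα)
      ((s2 α').2 ((s2 α').1.2 hqα)) ?_ n r2
    · rw [E1]; exact hα'.1
    · rw [E2]; exact hα'.2
    · intro z z1 z2 z3
      rw [E1] at z1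
      rw [E2] at z2
      refine huq.unique ⟨⟨z1, z2⟩, ?_⟩ ⟨hα', ?_⟩
      · rw [AlgCmp.intListEval_eq]; exact (s2 z).1.1 z3
      · rw [AlgCmp.intListEval_eq]; exact hqα
  have hM : AlgCmp.bdM y = |b.num| + |c.num| + (|b'.num| + |c'.num|) := by
    simp [AlgCmp.bdM, yb]
  have m1 : |α| ≤ (AlgCmp.bdM y : ℝ) := by
    refine (AlgCmp.abs_le_of_Icc hα).trans ?_
    rw [hM]
    have := abs_nonneg b'.num
    have := abs_nonneg c'.num
    exact_mod_cast (by omega : |b.num| + |c.num| ≤ |b.num| + |c.num| + (|b'.num| + |c'.num|))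
  have m2 : |α'| ≤ (AlgCmp.bdM y : ℝ) := by
    refine (AlgCmp.abs_le_of_Icc hα').trans ?_
    rw [hM]
    have := abs_nonneg b.num
    have := abs_nonneg c.num
    exact_mod_cast (by omega : |b'.num| + |c'.num| ≤ |b.num| + |c.num| + (|b'.num| + |c'.num|))
  have hED : AlgCmp.sepE y ≤ AlgCmp.grid y := by
    have h1 : AlgCmp.sepE y ≤ AlgCmp.scl y := by
      have := le_abs_self (AlgCmp.sepE y)
      unfold AlgCmp.scl; omega
    have h2 : 0 < ((b.den : ℤ) * c.den) * ((b'.den : ℤ) * c'.den) := by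
      have := hd b; have := hd c; have := hd b'; have := hd c'
      positivity
    rw [hgrid]
    nlinarith
  have hfin := AlgCmp.floor_cmp α α' (AlgCmp.grid y) hgpos (by
    intro hlt
    have := AlgCmp.separation hK3 g3 (AlgCmp.bdM y) α' α hlt m2 m1
      ((s3 α').1.2 (by rw [map_mul, hqα, mul_zero]))
      ((s3 α).1.2 (by rw [map_mul, hpα, zero_mul]))
    refine this.trans ?_
    have hED' : (AlgCmp.sepE y : ℝ) ≤ (AlgCmp.grid y : ℝ) := by exact_mod_cast hED
    exact mul_le_mul_of_nonneg_right hED' (sub_pos.2 hlt).le)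
  rw [← hfin, ← i1, ← i2]
  exact decide_eq_true_iff
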